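/- arXiv:1104.1014 — 2 statements merged into one kernel-verified Lean document; each statement's English description precedes it below -/
import Mathlib

section
/- Let M : ℝ → ℝ be continuous on [0,∞) and suppose the function g(ρ) = ρ·M(ρ) is strictly unimodal on [0,∞), i.e., there exists m > 0 such that g is strictly increasing on [0,m] and strictly decreasing on [m,∞). Then for any constants B > E > 0 there exists a unique p > 0 such that B·M(B·p) = E·M(E·p); equivalently, the MMSE difference function f(p) = B·M(B·p) − E·M(E·p) admits a unique zero on (0,∞). -/
/-- Proposition 3: if `g ρ = ρ * M ρ` is strictly unimodal on `[0,∞)`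
(strictly increasing on `[0,m]`, strictly decreasing on `[m,∞)` for some `m > 0`),
then for `B > E > 0` the MMSE difference function `p ↦ B·M(B·p) − E·M(E·p)`
admits a unique zero on `(0,∞)`. -/
theorem mmse_difference_unique_zero
    (M : ℝ → ℝ) (hM : ContinuousOn M (Set.Ici (0 : ℝ)))
    (m : ℝ) (hm : 0 < m)
    (hinc : StrictMonoOn (fun ρ : ℝ => ρ * M ρ) (Set.Icc 0 m))
    (hdec : StrictAntiOn (fun ρ : ℝ => ρ * M ρ) (Set.Ici m))
    (B E : ℝ) (hE : 0 < E) (hEB : E < B) :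
    ∃! p : ℝ, 0 < p ∧ B * M (B * p) = E * M (E * p) := by
  have hB : 0 < B := hE.trans hEB
  have key : ∀ p : ℝ, 0 < p → B * M (B * p) = E * M (E * p) → E * p < m ∧ m < B * p := by
    intro p hp h
    have hlt : E * p < B * p := mul_lt_mul_of_pos_right hEB hp
    have heq : (B * p) * M (B * p) = (E * p) * M (E * p) := by linear_combination p * h
    constructor
    · by_contra! hle
      exact (hdec hle (hle.trans hlt.le) hlt).ne heq
    · by_contra! hle
      exact (hinc ⟨by positivity, hlt.le.trans hle⟩ ⟨by positivity, hle⟩ hlt).ne' heq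
  have hle : m / B ≤ m / E := div_le_div_of_nonneg_left hm.le hE hEB.le
  have hcomp : ∀ c : ℝ, 0 < c →
      ContinuousOn (fun p : ℝ => (c * p) * M (c * p)) (Set.Icc (m / B) (m / E)) := by
    intro c hc
    refine ContinuousOn.mul (by fun_prop) (hM.comp (by fun_prop) ?_)
    intro p hp
    have hp0 : 0 < p := (div_pos hm hB).trans_le hp.1
    exact (mul_pos hc hp0).le
  have hleft : (E * (m / B)) * M (E * (m / B)) < (B * (m / B)) * M (B * (m / B)) := by
    rw [mul_div_cancel₀ m hB.ne']
    have hlt : E * (m / B) < m := by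
      rw [← mul_div_assoc, div_lt_iff₀ hB]
      nlinarith
    exact hinc ⟨by positivity, hlt.le⟩ ⟨hm.le, le_rfl⟩ hlt
  have hright : (B * (m / E)) * M (B * (m / E)) < (E * (m / E)) * M (E * (m / E)) := by
    rw [mul_div_cancel₀ m hE.ne']
    have hlt : m < B * (m / E) := by
      rw [← mul_div_assoc, lt_div_iff₀ hE]
      nlinarith
    exact hdec Set.self_mem_Ici hlt.le hlt
  obtain ⟨p, hp, hp_eq⟩ := intermediate_value_Icc' hle ((hcomp B hB).sub (hcomp E hE))
    ⟨(sub_neg.mpr hright).le, (sub_pos.mpr hleft).le⟩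
  have hp0 : 0 < p := (div_pos hm hB).trans_le hp.1
  have hpz : B * M (B * p) = E * M (E * p) := by
    apply mul_left_cancel₀ hp0.ne'
    have hsub : (B * p) * M (B * p) - (E * p) * M (E * p) = 0 := hp_eq
    linear_combination hsub
  have hmono : ∀ p q : ℝ, 0 < p → p < q → B * M (B * p) = E * M (E * p) →
      B * M (B * q) ≠ E * M (E * q) := by
    intro p q hp hpq h₁ h₂
    obtain ⟨_, hBp⟩ := key p hp h₁
    obtain ⟨hEq, _⟩ := key q (hp.trans hpq) h₂
    have hElt : E * p < E * q := mul_lt_mul_of_pos_left hpq hE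
    have hBlt : B * p < B * q := mul_lt_mul_of_pos_left hpq hB
    have hEg : (E * p) * M (E * p) < (E * q) * M (E * q) :=
      hinc ⟨by positivity, (hElt.trans hEq).le⟩
        ⟨(mul_pos hE (hp.trans hpq)).le, hEq.le⟩ hElt
    have hBg : (B * q) * M (B * q) < (B * p) * M (B * p) :=
      hdec hBp.le (hBp.trans hBlt).le hBlt
    linarith [congrArg (p * ·) h₁, congrArg (q * ·) h₂]
  refine ⟨p, ⟨hp0, hpz⟩, ?_⟩
  rintro q ⟨hq0, hqz⟩
  rcases lt_trichotomy q p with h | h | h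
  · exact absurd hpz (hmono q p hq0 h hqz)
  · exact h
  · exact absurd hqz (hmono p q hp0 h hpz)
end

section
/- Let M : ℝ → ℝ be continuous on [0,∞) and suppose the function g(ρ) = ρ·M(ρ) is strictly unimodal on [0,∞), i.e., there exists m > 0 such that g is strictly increasing on [0,m] and strictly decreasing on [m,∞). Let B > E > 0 and suppose p' > 0 satisfies g(B·p') = g(E·p'). Then for every p with 0 < p < p' one has g(B·p) > g(E·p) (i.e., B·M(B·p) > E·M(E·p)), and for every p > p' one has g(B·p) < g(E·p) (i.e., B·M(B·p) < E·M(E·p)). -/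
/-- For a strictly unimodal function, two distinct points at the same level lie on
opposite sides of the mode. -/
theorem mode_between_of_eq {g : ℝ → ℝ} {m a b : ℝ}
    (hinc : StrictMonoOn g (Set.Icc 0 m)) (hdec : StrictAntiOn g (Set.Ici m))
    (ha : 0 ≤ a) (hab : a < b) (h : g b = g a) : a < m ∧ m < b := by
  constructor
  · by_contra! hma
    exact (hdec hma (hma.trans hab.le) hab).ne h
  · by_contra! hbm
    exact (hinc ⟨ha, hab.le.trans hbm⟩ ⟨ha.trans hab.le, hbm⟩ hab).ne h.symm

/-- Sign structure of the MMSE difference around its unique zero (Appendix C):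
with `g ρ = ρ * M ρ` strictly unimodal on `[0,∞)` and `B > E > 0`, if
`p' > 0` satisfies `g (B·p') = g (E·p')`, then `g (B·p) > g (E·p)` for
`0 < p < p'` and `g (B·p) < g (E·p)` for `p > p'`. -/
theorem mmse_difference_sign_structure
    (M : ℝ → ℝ) (hM : ContinuousOn M (Set.Ici (0 : ℝ)))
    (m : ℝ) (hm : 0 < m)
    (hinc : StrictMonoOn (fun ρ : ℝ => ρ * M ρ) (Set.Icc 0 m))
    (hdec : StrictAntiOn (fun ρ : ℝ => ρ * M ρ) (Set.Ici m))
    (B E : ℝ) (hE : 0 < E) (hEB : E < B)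
    (p' : ℝ) (hp' : 0 < p')
    (heq : (B * p') * M (B * p') = (E * p') * M (E * p')) :
    (∀ p : ℝ, 0 < p → p < p' → (E * p) * M (E * p) < (B * p) * M (B * p)) ∧
    (∀ p : ℝ, p' < p → (B * p) * M (B * p) < (E * p) * M (E * p)) := by
  have hB : 0 < B := hE.trans hEB
  obtain ⟨hEm, hmB⟩ := mode_between_of_eq hinc hdec (mul_pos hE hp').le
    (mul_lt_mul_of_pos_right hEB hp') heq
  refine ⟨fun p hp hpp' => ?_, fun p hpp' => ?_⟩
  · have hEp : E * p < E * p' := mul_lt_mul_of_pos_left hpp' hE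
    have hBp : B * p < B * p' := mul_lt_mul_of_pos_left hpp' hB
    have hEBp : E * p < B * p := mul_lt_mul_of_pos_right hEB hp
    have hE0 : 0 ≤ E * p := (mul_pos hE hp).le
    rcases le_total (B * p) m with hle | hge
    · exact hinc ⟨hE0, hEBp.le.trans hle⟩ ⟨hE0.trans hEBp.le, hle⟩ hEBp
    · calc (E * p) * M (E * p) < (E * p') * M (E * p') :=
            hinc ⟨hE0, (hEp.trans hEm).le⟩ ⟨hE0.trans hEp.le, hEm.le⟩ hEp
        _ = (B * p') * M (B * p') := heq.symm
        _ < (B * p) * M (B * p) := hdec hge hmB.le hBp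
  · have hEp : E * p' < E * p := mul_lt_mul_of_pos_left hpp' hE
    have hBp : B * p' < B * p := mul_lt_mul_of_pos_left hpp' hB
    have hEBp : E * p < B * p := mul_lt_mul_of_pos_right hEB (hp'.trans hpp')
    have hE0 : 0 ≤ E * p' := (mul_pos hE hp').le
    rcases le_total m (E * p) with hge | hle
    · exact hdec hge (hge.trans hEBp.le) hEBp
    · calc (B * p) * M (B * p) < (B * p') * M (B * p') :=
            hdec hmB.le (hmB.trans hBp).le hBp
        _ = (E * p') * M (E * p') := heq
        _ < (E * p) * M (E * p) := hinc ⟨hE0, hEm.le⟩ ⟨hE0.trans hEp.le, hle⟩ hEp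
end
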